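/- arXiv:2101.06899 — 2 statements merged into one kernel-verified Lean document; each statement's English description precedes it below -/
import Mathlib

section
/- Let p be a prime with p ≡ 1 (mod 6) such that [-1,5]* splits Z_p with a splitter set B satisfying 1 ∈ B. Let H = ⟨-1,2,3,5⟩ be the subgroup of Z_p^* generated by the residues of -1, 2, 3, 5, and let B₁ = B ∩ H. Then there exists a choice of signs ε_k ∈ {1,-1} for each k ≥ 0 such that B₁ = ⋃_{k≥0} ε_k·8^k·⟨-2/5, -4/3⟩, or there exists a choice of signs ε_k ∈ {1,-1} such that B₁ = ⋃_{k≥0} ε_k·8^k·⟨-4/5, -2/3⟩, where ⟨x, y⟩ denotes the subgroup of Z_p^* generated by x and y, the fractions are computed in the field Z_p, and c·S = {c·s : s ∈ S}. -/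
/-- The subset of `ℤ_p` underlying the subgroup of `(ℤ_p)ˣ` generated by the
units whose values lie in `S`. -/
def genSet (p : ℕ) (S : Set (ZMod p)) : Set (ZMod p) :=
  (fun u : (ZMod p)ˣ => (u : ZMod p)) ''
    ((Subgroup.closure ((fun u : (ZMod p)ˣ => (u : ZMod p)) ⁻¹' S) :
      Subgroup (ZMod p)ˣ) : Set (ZMod p)ˣ)

/-- `M` splits `ℤ_p` with splitter set `B`: every nonzero element of `ℤ_p` has
a unique representation `m * b` with `m ∈ M`, `b ∈ B`, while `0` has no such
representation. -/
def SplitsWith (M : Set ℤ) (p : ℕ) (B : Set (ZMod p)) : Prop :=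
  (∀ g : ZMod p, g ≠ 0 → ∃! mb : ℤ × ZMod p,
    mb.1 ∈ M ∧ mb.2 ∈ B ∧ (mb.1 : ZMod p) * mb.2 = g) ∧
  ¬ ∃ m ∈ M, ∃ b ∈ B, (m : ZMod p) * b = 0

namespace SplitsWith

variable {p : ℕ} [Fact p.Prime] {B : Set (ZMod p)}

theorem eq_of_mul_eq {M : Set ℤ} (hB : SplitsWith M p B) {m n : ℤ} (hm : m ∈ M) (hn : n ∈ M)
    {b c : ZMod p} (hb : b ∈ B) (hc : c ∈ B) (h : (m : ZMod p) * b = n * c) : m = n ∧ b = c := by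
  have h0 : (m : ZMod p) * b ≠ 0 := fun h0 => hB.2 ⟨m, hm, b, hb, h0⟩
  have := (hB.1 _ h0).unique (y₁ := (m, b)) (y₂ := (n, c)) ⟨hm, hb, rfl⟩ ⟨hn, hc, h.symm⟩
  exact Prod.mk.inj this

theorem exists_mul_eq {M : Set ℤ} (hB : SplitsWith M p B) {g : ZMod p} (hg : g ≠ 0) :
    ∃ m ∈ M, ∃ b ∈ B, (m : ZMod p) * b = g := by
  obtain ⟨⟨m, b⟩, ⟨hm, hb, h⟩, -⟩ := hB.1 g hg
  exact ⟨m, hm, b, hb, h⟩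

theorem cast_ne_zero {M : Set ℤ} (hB : SplitsWith M p B) {b : ZMod p} (hb : b ∈ B) {m : ℤ}
    (hm : m ∈ M) : (m : ZMod p) ≠ 0 :=
  fun h => hB.2 ⟨m, hm, b, hb, by rw [h, zero_mul]⟩

theorem ne_zero {M : Set ℤ} (hB : SplitsWith M p B) {b : ZMod p} (hb : b ∈ B) {m : ℤ}
    (hm : m ∈ M) : b ≠ 0 :=
  fun h => hB.2 ⟨m, hm, b, hb, by rw [h, mul_zero]⟩

theorem two_three_five_ne_zero (hB : SplitsWith {-1, 1, 2, 3, 4, 5} p B) {b : ZMod p}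
    (hb : b ∈ B) :
    (2 : ZMod p) ≠ 0 ∧ (3 : ZMod p) ≠ 0 ∧ (5 : ZMod p) ≠ 0 := by
  refine ⟨?_, ?_, ?_⟩
  · exact_mod_cast hB.cast_ne_zero hb (m := 2) (by simp)
  · exact_mod_cast hB.cast_ne_zero hb (m := 3) (by simp)
  · exact_mod_cast hB.cast_ne_zero hb (m := 5) (by simp)

theorem ne_neg (hB : SplitsWith {-1, 1, 2, 3, 4, 5} p B) {b c : ZMod p} (hb : b ∈ B) (hc : c ∈ B) :
    c ≠ -b := fun h => by
  have := hB.eq_of_mul_eq (m := 1) (n := -1) (by simp) (by simp) hc hb (by simp [h])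
  simp at this

theorem ne_two_mul (hB : SplitsWith {-1, 1, 2, 3, 4, 5} p B) {b c : ZMod p} (hb : b ∈ B) (hc : c ∈ B) :
    c ≠ 2 * b := fun h => by
  have := hB.eq_of_mul_eq (m := 1) (n := 2) (by simp) (by simp) hc hb (by simp [h])
  simp at this

theorem ne_neg_two_mul (hB : SplitsWith {-1, 1, 2, 3, 4, 5} p B) {b c : ZMod p} (hb : b ∈ B)
    (hc : c ∈ B) :
    c ≠ -2 * b := fun h => by
  have := hB.eq_of_mul_eq (m := -1) (n := 2) (by simp) (by simp) hc hb (by simp [h])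
  simp at this

theorem ne_four_mul (hB : SplitsWith {-1, 1, 2, 3, 4, 5} p B) {b c : ZMod p} (hb : b ∈ B) (hc : c ∈ B) :
    c ≠ 4 * b := fun h => by
  have := hB.eq_of_mul_eq (m := 1) (n := 4) (by simp) (by simp) hc hb (by simp [h])
  simp at this

theorem ne_neg_four_mul (hB : SplitsWith {-1, 1, 2, 3, 4, 5} p B) {b c : ZMod p} (hb : b ∈ B)
    (hc : c ∈ B) :
    c ≠ -4 * b := fun h => by
  have := hB.eq_of_mul_eq (m := -1) (n := 4) (by simp) (by simp) hc hb (by simp [h])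
  simp at this

/-- `b`, `-2b/x` and `-4b/y` all lie in `B`. -/
def HasType (B : Set (ZMod p)) (x y b : ZMod p) : Prop :=
  b ∈ B ∧ -2 / x * b ∈ B ∧ -4 / y * b ∈ B

theorem hasType_or (hB : SplitsWith {-1, 1, 2, 3, 4, 5} p B) {b : ZMod p} (hb : b ∈ B) :
    HasType B 5 3 b ∨ HasType B 3 5 b := by
  obtain ⟨h2, h3, h5⟩ := hB.two_three_five_ne_zero hb
  have hb0 : b ≠ 0 := hB.ne_zero hb (m := 1) (by simp)
  have h4 : (4 : ZMod p) ≠ 0 := by exact_mod_cast hB.cast_ne_zero hb (m := 4) (by simp)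
  have key2 : -2 / 3 * b ∈ B ∨ -2 / 5 * b ∈ B := by
    obtain ⟨m, hm, c, hc, h⟩ := hB.exists_mul_eq (g := -2 * b) (by simp [h2, hb0])
    simp only [Set.mem_insert_iff, Set.mem_singleton_iff] at hm
    rcases hm with rfl | rfl | rfl | rfl | rfl | rfl <;> push_cast at h
    · exact (hB.ne_two_mul hb hc (by linear_combination -h)).elim
    · exact (hB.ne_neg_two_mul hb hc (by linear_combination h)).elim
    · exact (hB.ne_neg hb hc (mul_left_cancel₀ h2 (by linear_combination h))).elim
    · left
      convert hc using 1
      field_simp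
      linear_combination -h
    · exact (hB.ne_neg_two_mul hc hb (mul_left_cancel₀ h2 (by linear_combination h))).elim
    · right
      convert hc using 1
      field_simp
      linear_combination -h
  have key4 : -4 / 3 * b ∈ B ∨ -4 / 5 * b ∈ B := by
    obtain ⟨m, hm, c, hc, h⟩ := hB.exists_mul_eq (g := -4 * b) (by simp [h4, hb0])
    simp only [Set.mem_insert_iff, Set.mem_singleton_iff] at hm
    rcases hm with rfl | rfl | rfl | rfl | rfl | rfl <;> push_cast at h
    · exact (hB.ne_four_mul hb hc (by linear_combination -h)).elim
    · exact (hB.ne_neg_four_mul hb hc (by linear_combination h)).elim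
    · exact (hB.ne_neg_two_mul hb hc (mul_left_cancel₀ h2 (by linear_combination h))).elim
    · left
      convert hc using 1
      field_simp
      linear_combination -h
    · exact (hB.ne_neg hb hc (mul_left_cancel₀ h4 (by linear_combination h))).elim
    · right
      convert hc using 1
      field_simp
      linear_combination -h
  rcases key2 with k2 | k2 <;> rcases key4 with k4 | k4
  · exact (hB.ne_two_mul k2 k4 (by ring)).elim
  · exact Or.inr ⟨hb, k2, k4⟩
  · exact Or.inl ⟨hb, k2, k4⟩
  · exact (hB.ne_two_mul k2 k4 (by ring)).elim

variable {x y : ZMod p}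

theorem hasType_or_swap (hB : SplitsWith {-1, 1, 2, 3, 4, 5} p B)
    (hxy : x = 5 ∧ y = 3 ∨ x = 3 ∧ y = 5)
    {b : ZMod p} (hb : b ∈ B) : HasType B x y b ∨ HasType B y x b := by
  rcases hxy with ⟨rfl, rfl⟩ | ⟨rfl, rfl⟩
  · exact hB.hasType_or hb
  · exact (hB.hasType_or hb).symm

theorem hasType_generators (hB : SplitsWith {-1, 1, 2, 3, 4, 5} p B)
    (hxy : x = 5 ∧ y = 3 ∨ x = 3 ∧ y = 5)
    {b : ZMod p} (h : HasType B x y b) :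
    HasType B x y (-2 / x * b) ∧ HasType B x y (-4 / y * b) := by
  obtain ⟨-, hu, hv⟩ := h
  have hu' : HasType B x y (-2 / x * b) := by
    refine (hB.hasType_or_swap hxy hu).resolve_right fun h => ?_
    rcases hB.hasType_or_swap hxy hv with h' | h'
    · exact hB.ne_two_mul h.2.1 h'.2.1 (by ring)
    · exact hB.ne_four_mul h.2.1 h'.2.2 (by ring)
  refine ⟨hu', (hB.hasType_or_swap hxy hv).resolve_right fun h => ?_⟩
  exact hB.ne_two_mul hu'.2.2 h.2.2 (by ring)

theorem hasType_closure (hB : SplitsWith {-1, 1, 2, 3, 4, 5} p B)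
    (hxy : x = 5 ∧ y = 3 ∨ x = 3 ∧ y = 5)
    {b k : ZMod p} (h : HasType B x y b) (hk : k ∈ genSet p {-2 / x, -4 / y}) :
    HasType B x y (k * b) := by
  obtain ⟨u, hu, rfl⟩ := hk
  rw [SetLike.mem_coe, ← Subgroup.mem_toSubmonoid, Subgroup.closure_toSubmonoid_of_finite] at hu
  induction hu using Submonoid.closure_induction generalizing b with
  | mem v hv =>
    rcases hv with hv | hv
    · simpa [hv] using (hB.hasType_generators hxy h).1
    · rw [Set.mem_singleton_iff] at hv
      simpa [hv] using (hB.hasType_generators hxy h).2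
  | one => simpa using h
  | mul v w _ _ ihv ihw => simpa [mul_assoc] using ihv (ihw h)

theorem eight_mul_mem (hB : SplitsWith {-1, 1, 2, 3, 4, 5} p B)
    (hxy : x = 5 ∧ y = 3 ∨ x = 3 ∧ y = 5)
    {b : ZMod p} (h : HasType B x y b) : 8 * b ∈ B ∨ -8 * b ∈ B := by
  obtain ⟨hb, hu, hv⟩ := h
  obtain ⟨h2, h3, h5⟩ := hB.two_three_five_ne_zero hb
  have hb0 : b ≠ 0 := hB.ne_zero hb (m := 1) (by simp)
  have h4 : (4 : ZMod p) ≠ 0 := by exact_mod_cast hB.cast_ne_zero hb (m := 4) (by simp)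
  have h8 : (8 : ZMod p) ≠ 0 := by
    have := mul_ne_zero h2 h4
    norm_num at this
    exact this
  obtain ⟨m, hm, c, hc, h⟩ := hB.exists_mul_eq (g := -8 * b) (by simp [h8, hb0])
  have hx : x ≠ 0 := by rcases hxy with ⟨rfl, rfl⟩ | ⟨rfl, rfl⟩ <;> assumption
  have hy : y ≠ 0 := by rcases hxy with ⟨rfl, rfl⟩ | ⟨rfl, rfl⟩ <;> assumption
  have notx : x * c ≠ -8 * b := fun h => hB.ne_four_mul hu hc (by
    field_simp
    linear_combination h)
  have noty : y * c ≠ -8 * b := fun h => hB.ne_two_mul hv hc (by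
    field_simp
    linear_combination h)
  have not35 : 3 * c ≠ -8 * b ∧ 5 * c ≠ -8 * b := by
    rcases hxy with ⟨rfl, rfl⟩ | ⟨rfl, rfl⟩
    exacts [⟨noty, notx⟩, ⟨notx, noty⟩]
  simp only [Set.mem_insert_iff, Set.mem_singleton_iff] at hm
  rcases hm with rfl | rfl | rfl | rfl | rfl | rfl <;> push_cast at h
  · left
    convert hc using 1
    linear_combination h
  · right
    convert hc using 1
    linear_combination -h
  · exact (hB.ne_neg_four_mul hb hc (mul_left_cancel₀ h2 (by linear_combination h))).elim
  · exact (not35.1 h).elim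
  · exact (hB.ne_neg_two_mul hb hc (mul_left_cancel₀ h4 (by linear_combination h))).elim
  · exact (not35.2 h).elim

theorem hasType_eight_mul (hB : SplitsWith {-1, 1, 2, 3, 4, 5} p B)
    (hxy : x = 5 ∧ y = 3 ∨ x = 3 ∧ y = 5)
    {b : ZMod p} (h : HasType B x y b) :
    HasType B x y (8 * b) ∨ HasType B x y (-8 * b) := by
  have hu := hB.eight_mul_mem hxy (hB.hasType_generators hxy h).1
  rcases hB.eight_mul_mem hxy h with hs | hs
  · refine Or.inl ((hB.hasType_or_swap hxy hs).resolve_right fun h' => ?_)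
    rcases hu with hu | hu
    · exact hB.ne_two_mul hu h'.2.2 (by ring)
    · exact hB.ne_neg_two_mul hu h'.2.2 (by ring)
  · refine Or.inr ((hB.hasType_or_swap hxy hs).resolve_right fun h' => ?_)
    rcases hu with hu | hu
    · exact hB.ne_neg_two_mul hu h'.2.2 (by ring)
    · exact hB.ne_two_mul hu h'.2.2 (by ring)

theorem exists_sign_hasType (hB : SplitsWith {-1, 1, 2, 3, 4, 5} p B)
    (hxy : x = 5 ∧ y = 3 ∨ x = 3 ∧ y = 5)
    (h : HasType B x y 1) (k : ℕ) :
    ∃ e : ZMod p, (e = 1 ∨ e = -1) ∧ HasType B x y (e * 8 ^ k) := by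
  induction k with
  | zero => exact ⟨1, Or.inl rfl, by simpa using h⟩
  | succ k ih =>
    obtain ⟨e, he, hk⟩ := ih
    rcases hB.hasType_eight_mul hxy hk with h' | h'
    · refine ⟨e, he, ?_⟩
      convert h' using 1
      ring
    · refine ⟨-e, ?_, ?_⟩
      · rcases he with rfl | rfl <;> simp
      · convert h' using 1
        ring

theorem exists_eq_two_pow_mul {g : ZMod p} (h2 : (2 : ZMod p) ≠ 0) (h3 : (3 : ZMod p) ≠ 0)
    (h5 : (5 : ZMod p) ≠ 0) (hxy : x = 5 ∧ y = 3 ∨ x = 3 ∧ y = 5)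
    (hg : g ∈ genSet p {-1, 2, 3, 5}) :
    ∃ e : ZMod p, (e = 1 ∨ e = -1) ∧ ∃ n : ℕ, ∃ k ∈ genSet p {-2 / x, -4 / y},
      g = e * 2 ^ n * k := by
  have hx : x ≠ 0 := by rcases hxy with ⟨rfl, rfl⟩ | ⟨rfl, rfl⟩ <;> assumption
  have hy : y ≠ 0 := by rcases hxy with ⟨rfl, rfl⟩ | ⟨rfl, rfl⟩ <;> assumption
  have h4 : (4 : ZMod p) ≠ 0 := by
    have := mul_ne_zero h2 h2
    norm_num at this
    exact this
  have one_mem : (1 : ZMod p) ∈ genSet p {-2 / x, -4 / y} := ⟨1, one_mem _, by simp⟩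
  have inv_mem {z : ZMod p} (hz : z ≠ 0) (h : z = -2 / x ∨ z = -4 / y) :
      z⁻¹ ∈ genSet p {-2 / x, -4 / y} :=
    ⟨(Units.mk0 z hz)⁻¹, inv_mem (Subgroup.subset_closure (by simpa using h)), by simp⟩
  have genx : ∃ e : ZMod p, (e = 1 ∨ e = -1) ∧ ∃ n : ℕ, ∃ k ∈ genSet p {-2 / x, -4 / y},
      x = e * 2 ^ n * k := by
    refine ⟨-1, Or.inr rfl, 1, _, inv_mem (z := -2 / x) (by simp [h2, hx]) (Or.inl rfl), ?_⟩
    field_simp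
  have geny : ∃ e : ZMod p, (e = 1 ∨ e = -1) ∧ ∃ n : ℕ, ∃ k ∈ genSet p {-2 / x, -4 / y},
      y = e * 2 ^ n * k := by
    refine ⟨-1, Or.inr rfl, 2, _, inv_mem (z := -4 / y) (by simp [h4, hy]) (Or.inr rfl), ?_⟩
    field_simp
    norm_num
  obtain ⟨u, hu, rfl⟩ := hg
  rw [SetLike.mem_coe, ← Subgroup.mem_toSubmonoid, Subgroup.closure_toSubmonoid_of_finite] at hu
  induction hu using Submonoid.closure_induction with
  | mem v hv =>
    rcases hv with hv | hv | hv | hv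
    · exact ⟨-1, Or.inr rfl, 0, 1, one_mem, by simpa using hv⟩
    · exact ⟨1, Or.inl rfl, 1, 1, one_mem, by simpa using hv⟩
    · rcases hxy with ⟨rfl, rfl⟩ | ⟨rfl, rfl⟩
      · simpa only [hv] using geny
      · simpa only [hv] using genx
    · rw [Set.mem_singleton_iff] at hv
      rcases hxy with ⟨rfl, rfl⟩ | ⟨rfl, rfl⟩
      · simpa only [hv] using genx
      · simpa only [hv] using geny
  | one => exact ⟨1, Or.inl rfl, 0, 1, one_mem, by simp⟩
  | mul v w _ _ ihv ihw =>
    obtain ⟨e, he, n, -, ⟨k, hk, rfl⟩, h⟩ := ihv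
    obtain ⟨e', he', n', -, ⟨k', hk', rfl⟩, h'⟩ := ihw
    refine ⟨e * e', ?_, n + n', _, ⟨k * k', mul_mem hk hk', rfl⟩, ?_⟩
    · rcases he with rfl | rfl <;> rcases he' with rfl | rfl <;> simp
    · simp only [Units.val_mul] at h h' ⊢
      rw [h, h']
      ring

theorem sign_mul_mem_genSet {e g : ZMod p} (h2 : (2 : ZMod p) ≠ 0) (h3 : (3 : ZMod p) ≠ 0)
    (h5 : (5 : ZMod p) ≠ 0) (hxy : x = 5 ∧ y = 3 ∨ x = 3 ∧ y = 5) (he : e = 1 ∨ e = -1) (k : ℕ)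
    (hg : g ∈ genSet p {-2 / x, -4 / y}) : e * 8 ^ k * g ∈ genSet p {-1, 2, 3, 5} := by
  set H := Subgroup.closure ((fun u : (ZMod p)ˣ => (u : ZMod p)) ⁻¹' {-1, 2, 3, 5})
  have mem {u : (ZMod p)ˣ} (hu : (u : ZMod p) ∈ ({-1, 2, 3, 5} : Set (ZMod p))) : u ∈ H :=
    Subgroup.subset_closure hu
  have hm1 : (-1 : (ZMod p)ˣ) ∈ H := mem (by simp)
  have hm2 : Units.mk0 (2 : ZMod p) h2 ∈ H := mem (by simp)
  have hx : x ≠ 0 := by rcases hxy with ⟨rfl, rfl⟩ | ⟨rfl, rfl⟩ <;> assumption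
  have hy : y ≠ 0 := by rcases hxy with ⟨rfl, rfl⟩ | ⟨rfl, rfl⟩ <;> assumption
  have hmx : Units.mk0 x hx ∈ H := mem (by rcases hxy with ⟨rfl, rfl⟩ | ⟨rfl, rfl⟩ <;> simp)
  have hmy : Units.mk0 y hy ∈ H := mem (by rcases hxy with ⟨rfl, rfl⟩ | ⟨rfl, rfl⟩ <;> simp)
  have hle : Subgroup.closure ((fun u : (ZMod p)ˣ => (u : ZMod p)) ⁻¹' {-2 / x, -4 / y}) ≤ H := by
    rw [Subgroup.closure_le]
    rintro u (hu | hu)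
    · have : u = -1 * Units.mk0 2 h2 * (Units.mk0 x hx)⁻¹ := by
        ext
        simp [hu, div_eq_mul_inv]
      rw [this]
      exact mul_mem (mul_mem hm1 hm2) (inv_mem hmx)
    · rw [Set.mem_singleton_iff] at hu
      have : u = -1 * Units.mk0 2 h2 ^ 2 * (Units.mk0 y hy)⁻¹ := by
        ext
        simp [hu, div_eq_mul_inv]
        norm_num
      rw [this]
      exact mul_mem (mul_mem hm1 (pow_mem hm2 2)) (inv_mem hmy)
  obtain ⟨u, hu, rfl⟩ := hg
  have hs : ∃ s ∈ H, (s : ZMod p) = e := by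
    rcases he with rfl | rfl
    · exact ⟨1, one_mem _, by simp⟩
    · exact ⟨-1, hm1, by simp⟩
  obtain ⟨s, hs, rfl⟩ := hs
  refine ⟨s * (Units.mk0 2 h2 ^ 3) ^ k * u,
    mul_mem (mul_mem hs (pow_mem (pow_mem hm2 3) k)) (hle hu), ?_⟩
  simp
  norm_num

theorem inter_genSet_eq (hB : SplitsWith {-1, 1, 2, 3, 4, 5} p B)
    (hxy : x = 5 ∧ y = 3 ∨ x = 3 ∧ y = 5)
    (h : HasType B x y 1) :
    ∃ ε : ℕ → ZMod p, (∀ k, ε k = 1 ∨ ε k = -1) ∧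
      B ∩ genSet p {-1, 2, 3, 5} =
        ⋃ k : ℕ, (fun h : ZMod p => ε k * 8 ^ k * h) '' genSet p {-2 / x, -4 / y} := by
  obtain ⟨h2, h3, h5⟩ := hB.two_three_five_ne_zero h.1
  choose ε hε hT using hB.exists_sign_hasType hxy h
  have mem (k : ℕ) {g : ZMod p} (hg : g ∈ genSet p {-2 / x, -4 / y}) : ε k * 8 ^ k * g ∈ B := by
    rw [mul_comm]
    exact (hB.hasType_closure hxy (hT k) hg).1
  refine ⟨ε, hε, Set.Subset.antisymm ?_ ?_⟩
  · rintro b ⟨hb, hbH⟩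
    obtain ⟨e, he, n, g, hg, hbg⟩ := exists_eq_two_pow_mul h2 h3 h5 hxy hbH
    refine Set.mem_iUnion.2 ⟨n / 3, g, hg, ?_⟩
    have hs := mem (n / 3) hg
    set q := n / 3
    obtain ⟨t, ht, het⟩ : ∃ t : ZMod p, (t = 1 ∨ t = -1) ∧ e = t * ε q := by
      rcases he with rfl | rfl <;> rcases hε q with hq | hq <;> rw [hq] <;> simp
    have hb' : b = t * 2 ^ (n % 3) * (ε q * 8 ^ q * g) := by
      have : (2 : ZMod p) ^ n = 2 ^ (n % 3) * 8 ^ q := by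
        rw [show (8 : ZMod p) = 2 ^ 3 by norm_num, ← pow_mul, ← pow_add, Nat.mod_add_div]
      rw [hbg, het, this]
      ring
    have hn : n % 3 < 3 := Nat.mod_lt _ (by norm_num)
    change ε q * 8 ^ q * g = b
    generalize ε q * 8 ^ q * g = s at hs hb' ⊢
    generalize n % 3 = r at hn hb'
    interval_cases r <;> rcases ht with rfl | rfl
    · simp [hb']
    · exact (hB.ne_neg hs hb (by simpa using hb')).elim
    · exact (hB.ne_two_mul hs hb (by simpa using hb')).elim
    · exact (hB.ne_neg_two_mul hs hb (by simpa using hb')).elim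
    · exact (hB.ne_four_mul hs hb (by rw [hb']; ring)).elim
    · exact (hB.ne_neg_four_mul hs hb (by rw [hb']; ring)).elim
  · refine Set.iUnion_subset fun k => ?_
    rintro _ ⟨g, hg, rfl⟩
    exact ⟨mem k hg, sign_mul_mem_genSet h2 h3 h5 hxy (hε k) k hg⟩

end SplitsWith

/-- If `p ≡ 1 (mod 6)` and `[-1,5]*` splits `ℤ_p` with splitter set `B ∋ 1`,
then `B₁ = B ∩ ⟨-1,2,3,5⟩` is one of the two unions of signed cosets
`⋃ₖ εₖ·8^k·⟨-2/5, -4/3⟩` or `⋃ₖ εₖ·8^k·⟨-4/5, -2/3⟩`. -/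
theorem splitter_set_structure (p : ℕ) [hp : Fact p.Prime] (hmod : p % 6 = 1)
    (B : Set (ZMod p))
    (hB : SplitsWith ({-1, 1, 2, 3, 4, 5} : Set ℤ) p B)
    (h1B : (1 : ZMod p) ∈ B) :
    (∃ ε : ℕ → ZMod p, (∀ k, ε k = 1 ∨ ε k = -1) ∧
      B ∩ genSet p {(-1 : ZMod p), 2, 3, 5} =
        ⋃ k : ℕ, (fun h : ZMod p => ε k * 8 ^ k * h) ''
          genSet p {((-2 : ZMod p) / 5), ((-4 : ZMod p) / 3)}) ∨
    (∃ ε : ℕ → ZMod p, (∀ k, ε k = 1 ∨ ε k = -1) ∧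
      B ∩ genSet p {(-1 : ZMod p), 2, 3, 5} =
        ⋃ k : ℕ, (fun h : ZMod p => ε k * 8 ^ k * h) ''
          genSet p {((-4 : ZMod p) / 5), ((-2 : ZMod p) / 3)}) := by
  rcases hB.hasType_or h1B with h | h
  · exact Or.inl (hB.inter_genSet_eq (Or.inl ⟨rfl, rfl⟩) h)
  · right
    rw [Set.pair_comm (-4 / 5 : ZMod p)]
    exact hB.inter_genSet_eq (Or.inr ⟨rfl, rfl⟩) h
end

section
/- Let p be a prime with p ≡ 1 (mod 6) such that [-1,5]* splits Z_p with a splitter set B satisfying 1 ∈ B. Then, computing all fractions in the field Z_p, either both -2/3 ∈ B and -4/5 ∈ B, or both -2/5 ∈ B and -4/3 ∈ B. -/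
/-- In a splitting, an element of `ℤ_p` determines its multiplier. -/
theorem SplitsWith.multiplier_unique {M : Set ℤ} {p : ℕ} {B : Set (ZMod p)}
    (h : SplitsWith M p B) {m n : ℤ} {b c : ZMod p} (hm : m ∈ M) (hn : n ∈ M)
    (hb : b ∈ B) (hc : c ∈ B) (heq : (m : ZMod p) * b = n * c) : m = n := by
  have hne : (m : ZMod p) * b ≠ 0 := fun h0 => h.2 ⟨m, hm, b, hb, h0⟩
  exact congrArg Prod.fst
    ((h.1 _ hne).unique (y₁ := (m, b)) (y₂ := (n, c)) ⟨hm, hb, rfl⟩ ⟨hn, hc, heq.symm⟩)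

/-- In a splitting whose splitter set contains `1`, no multiplier vanishes in `ℤ_p`. -/
theorem SplitsWith.cast_ne_zero_s18 {M : Set ℤ} {p : ℕ} {B : Set (ZMod p)}
    (h : SplitsWith M p B) (h1 : (1 : ZMod p) ∈ B) {m : ℤ} (hm : m ∈ M) :
    (m : ZMod p) ≠ 0 := fun h0 => h.2 ⟨m, hm, 1, h1, by rw [h0, zero_mul]⟩

/-- If `p ≡ 1 (mod 6)` and `[-1,5]*` splits `ℤ_p` with splitter set `B ∋ 1`,
then either `-2/3, -4/5 ∈ B` or `-2/5, -4/3 ∈ B`. -/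
theorem splitter_contains_pair (p : ℕ) [hp : Fact p.Prime] (hmod : p % 6 = 1)
    (B : Set (ZMod p))
    (hB : SplitsWith ({-1, 1, 2, 3, 4, 5} : Set ℤ) p B)
    (h1B : (1 : ZMod p) ∈ B) :
    (((-2 : ZMod p) / 3) ∈ B ∧ ((-4 : ZMod p) / 5) ∈ B) ∨
    (((-2 : ZMod p) / 5) ∈ B ∧ ((-4 : ZMod p) / 3) ∈ B) := by
  have h2 : (2 : ZMod p) ≠ 0 := by exact_mod_cast hB.cast_ne_zero_s18 h1B (m := 2) (by simp)
  have h3 : (3 : ZMod p) ≠ 0 := by exact_mod_cast hB.cast_ne_zero_s18 h1B (m := 3) (by simp)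
  have h4 : (4 : ZMod p) ≠ 0 := by exact_mod_cast hB.cast_ne_zero_s18 h1B (m := 4) (by simp)
  have h5 : (5 : ZMod p) ≠ 0 := by exact_mod_cast hB.cast_ne_zero_s18 h1B (m := 5) (by simp)
  have conflict : ∀ m n : ℤ, m ∈ ({-1, 1, 2, 3, 4, 5} : Set ℤ) →
      n ∈ ({-1, 1, 2, 3, 4, 5} : Set ℤ) → m ≠ n → ∀ b ∈ B, ∀ c ∈ B,
      (m : ZMod p) * b ≠ n * c :=
    fun m n hm hn hmn b hb c hc heq => hmn (hB.multiplier_unique hm hn hb hc heq)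
  have hneg_two : (-2 : ZMod p) / 3 ∈ B ∨ (-2 : ZMod p) / 5 ∈ B := by
    obtain ⟨⟨m, b⟩, ⟨hm, hb, hmb⟩, -⟩ := hB.1 (-2) (neg_ne_zero.mpr h2)
    simp only [Set.mem_insert_iff, Set.mem_singleton_iff] at hm hb hmb
    rcases hm with rfl | rfl | rfl | rfl | rfl | rfl <;> push_cast at hmb
    · exact (conflict 1 2 (by simp) (by simp) (by decide) b hb 1 h1B
        (by push_cast; linear_combination -hmb)).elim
    · exact (conflict (-1) 2 (by simp) (by simp) (by decide) b hb 1 h1B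
        (by push_cast; linear_combination -hmb)).elim
    · have hb' : b = -1 := mul_left_cancel₀ h2 (by linear_combination hmb)
      exact (conflict 1 (-1) (by simp) (by simp) (by decide) b hb 1 h1B
        (by push_cast; linear_combination hb')).elim
    · exact Or.inl (by rwa [← hmb, mul_div_cancel_left₀ b h3])
    · have hb' : 2 * b = -1 := mul_left_cancel₀ h2 (by linear_combination hmb)
      exact (conflict 2 (-1) (by simp) (by simp) (by decide) b hb 1 h1B
        (by push_cast; linear_combination hb')).elim
    · exact Or.inr (by rwa [← hmb, mul_div_cancel_left₀ b h5])
  have hneg_four : (-4 : ZMod p) / 3 ∈ B ∨ (-4 : ZMod p) / 5 ∈ B := by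
    obtain ⟨⟨m, b⟩, ⟨hm, hb, hmb⟩, -⟩ := hB.1 (-4) (neg_ne_zero.mpr h4)
    simp only [Set.mem_insert_iff, Set.mem_singleton_iff] at hm hb hmb
    rcases hm with rfl | rfl | rfl | rfl | rfl | rfl <;> push_cast at hmb
    · exact (conflict 1 4 (by simp) (by simp) (by decide) b hb 1 h1B
        (by push_cast; linear_combination -hmb)).elim
    · exact (conflict (-1) 4 (by simp) (by simp) (by decide) b hb 1 h1B
        (by push_cast; linear_combination -hmb)).elim
    · have hb' : b = -2 := mul_left_cancel₀ h2 (by linear_combination hmb)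
      exact (conflict (-1) 2 (by simp) (by simp) (by decide) b hb 1 h1B
        (by push_cast; linear_combination -hb')).elim
    · exact Or.inl (by rwa [← hmb, mul_div_cancel_left₀ b h3])
    · have hb' : b = -1 := mul_left_cancel₀ h4 (by linear_combination hmb)
      exact (conflict 1 (-1) (by simp) (by simp) (by decide) b hb 1 h1B
        (by push_cast; linear_combination hb')).elim
    · exact Or.inr (by rwa [← hmb, mul_div_cancel_left₀ b h5])
  have not_both : ∀ d : ZMod p, (-2 : ZMod p) / d ∈ B → (-4 : ZMod p) / d ∉ B :=
    fun d ha hb => conflict 4 2 (by simp) (by simp) (by decide) _ ha _ hb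
      (by push_cast; ring)
  rcases hneg_two with ha | ha <;> rcases hneg_four with hb | hb
  · exact (not_both 3 ha hb).elim
  · exact Or.inl ⟨ha, hb⟩
  · exact Or.inr ⟨ha, hb⟩
  · exact (not_both 5 ha hb).elim
end
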